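/- For every integer m ≥ 1, the determinant of the m × m integer matrix whose (a,c) entry, for 1 ≤ a ≤ m and 1 ≤ c ≤ m, is the binomial coefficient binom(2c, 2a−2), is an odd integer; in particular this matrix is invertible over ℚ. -/

import Mathlib

/-- The bidiagonal factor. -/
def bidiagFactor (m : ℕ) : Matrix (Fin m) (Fin m) (ZMod 2) :=
  fun a k => (if k = a then 1 else 0) + (if (k : ℕ) + 1 = a then 1 else 0)

/-- The Pascal factor. -/
def pascalFactor (m : ℕ) : Matrix (Fin m) (Fin m) (ZMod 2) :=
  fun k c => (Nat.choose c k : ZMod 2)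

theorem det_bidiagFactor (m : ℕ) : (bidiagFactor m).det = 1 := by
  rw [Matrix.det_of_isLowerTriangular]
  · simp [bidiagFactor]
  · intro i j hij
    have h : i < j := hij
    have h1 : j ≠ i := ne_of_gt h
    have h2 : ¬ ((j : ℕ) + 1 = i) := by
      have : (i : ℕ) < j := h
      omega
    simp [bidiagFactor, h1, h2]

theorem det_pascalFactor (m : ℕ) : (pascalFactor m).det = 1 := by
  rw [Matrix.det_of_isUpperTriangular]
  · simp [pascalFactor]
  · intro i j hij
    have h : (j : ℕ) < i := hij
    simp [pascalFactor, Nat.choose_eq_zero_of_lt h]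

theorem choose_two_mul_cast (n k : ℕ) :
    (Nat.choose (2 * n) (2 * k) : ZMod 2) = (Nat.choose n k : ZMod 2) := by
  have : Fact (Nat.Prime 2) := ⟨Nat.prime_two⟩
  have h := Choose.choose_modEq_choose_mod_mul_choose_div_nat (n := 2 * n) (k := 2 * k) (p := 2)
  simp at h
  exact (ZMod.natCast_eq_natCast_iff _ _ _).2 h

theorem factor_mul (m : ℕ) (a c : Fin m) :
    (bidiagFactor m * pascalFactor m) a c = (Nat.choose ((c : ℕ) + 1) a : ZMod 2) := by
  simp only [Matrix.mul_apply, bidiagFactor, pascalFactor, add_mul, Finset.sum_add_distrib,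
    ite_mul, one_mul, zero_mul, Finset.sum_ite_eq', Finset.mem_univ, if_true]
  obtain ⟨a, ha⟩ := a
  cases a with
  | zero => simp
  | succ b =>
    have : ∀ k : Fin m, ((k : ℕ) + 1 = b + 1) ↔ k = ⟨b, by omega⟩ := by
      intro k
      rw [Fin.ext_iff]
      simp
    simp only [this, Finset.sum_ite_eq', Finset.mem_univ, if_true, Nat.choose_succ_succ]
    push_cast
    ring

/-- The integer matrix. -/
def binomInt (m : ℕ) : Matrix (Fin m) (Fin m) ℤ :=
  fun a c => (Nat.choose (2 * ((c : ℕ) + 1)) (2 * ((a : ℕ) + 1) - 2) : ℤ)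

theorem binomInt_det_odd (m : ℕ) : Odd (binomInt m).det := by
  rw [← ZMod.intCast_eq_one_iff_odd, Int.cast_det]
  have h : (binomInt m).map (fun x : ℤ => (x : ZMod 2)) = bidiagFactor m * pascalFactor m := by
    ext a c
    rw [factor_mul, ← choose_two_mul_cast]
    have : 2 * ((a : ℕ) + 1) - 2 = 2 * a := by omega
    simp [binomInt, this]
  rw [h, Matrix.det_mul, det_bidiagFactor, det_pascalFactor, one_mul]

theorem binom_matrix_det_odd (m : ℕ) (hm : 1 ≤ m) :
    Odd (Matrix.det (fun a c : Fin m =>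
        (Nat.choose (2 * ((c : ℕ) + 1)) (2 * ((a : ℕ) + 1) - 2) : ℤ))) ∧
    Matrix.det (fun a c : Fin m =>
        (Nat.choose (2 * ((c : ℕ) + 1)) (2 * ((a : ℕ) + 1) - 2) : ℚ)) ≠ 0 := by
  have h := binomInt_det_odd m
  refine ⟨h, ?_⟩
  have hmap : (fun a c : Fin m =>
      (Nat.choose (2 * ((c : ℕ) + 1)) (2 * ((a : ℕ) + 1) - 2) : ℚ)) =
      (binomInt m).map (fun x : ℤ => (x : ℚ)) := by
    funext a c
    simp [binomInt]
  intro h0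
  have h1 : (((binomInt m).det : ℤ) : ℚ) = 0 :=
    (Int.cast_det _).trans ((congrArg Matrix.det hmap).symm.trans h0)
  have hz : (binomInt m).det = 0 := by exact_mod_cast h1
  rw [hz] at h
  exact absurd h (by decide)
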